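/- arXiv:2301.11926 — 3 statements merged into one kernel-verified Lean document; each statement's English description precedes it below -/
import Mathlib

section
/- Let θ : ℝ → ℝ be continuous and not a polynomial (i.e., there is no polynomial p with θ(x) = p(x) for all x ∈ ℝ). Then for every n, m ∈ ℕ, every compact set K ⊆ ℝⁿ, every continuous function h : K → ℝᵐ, and every ε > 0, there exist k ∈ ℕ, a matrix A ∈ ℝ^{k×n}, a vector a ∈ ℝᵏ, and a matrix B ∈ ℝ^{m×k} such that sup_{u ∈ K} |h(u) − B·θ(Au + a)| < ε, where θ is applied componentwise and |·| denotes the Euclidean norm on ℝᵐ. -/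
open MeasureTheory Filter Topology Convolution ContinuousLinearMap

namespace UAT

lemma integral_mem_closed {E : Type*} [NormedAddCommGroup E] [NormedSpace ℝ E] [CompleteSpace E]
    (N : Submodule ℝ E) (hN : IsClosed (N : Set E)) (F : ℝ → E) (hF : Continuous F)
    (hc : HasCompactSupport F) (hm : ∀ t, F t ∈ N) : ∫ t, F t ∈ N := by
  have : CompleteSpace N := hN.completeSpace_coe
  let G : ℝ → N := fun t => ⟨F t, hm t⟩
  have hG : Continuous G := hF.subtype_mk _
  have hGc : HasCompactSupport G := by
    apply HasCompactSupport.intro hc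
    intro x hx
    exact Subtype.ext (image_eq_zero_of_notMem_tsupport (f := F) hx)
  have := N.subtypeL.integral_comp_comm (μ := volume) (hG.integrable_of_hasCompactSupport hGc)
  have h2 : ∫ t, F t = ((∫ t, G t : N) : E) := this
  rw [h2]
  exact Subtype.mem _

lemma deriv_mem_closed {E : Type*} [NormedAddCommGroup E] [NormedSpace ℝ E]
    (N : Submodule ℝ E) (hN : IsClosed (N : Set E)) (u : ℝ → E) (v : E) (w : ℝ)
    (hu : HasDerivAt u v w) (hm : ∀ t, u t ∈ N) : v ∈ N := by
  have := hasDerivAt_iff_tendsto_slope.1 hu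
  refine hN.mem_of_tendsto this (Eventually.of_forall fun t => ?_)
  simp only [slope, vsub_eq_sub]
  exact N.smul_mem _ (N.sub_mem (hm _) (hm _))

variable {X : Type*} [TopologicalSpace X] [CompactSpace X]

lemma hasDerivAt_curve (u v : ℝ → C(X, ℝ)) (hv : Continuous v)
    (h : ∀ w x, HasDerivAt (fun w => u w x) (v w x) w) (w : ℝ) : HasDerivAt u (v w) w := by
  have key : ∀ w, u w = u 0 + ∫ t in (0:ℝ)..w, v t := by
    intro w
    ext x
    have h1 : (∫ t in (0:ℝ)..w, v t) x = ∫ t in (0:ℝ)..w, v t x :=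
      ((ContinuousMap.evalCLM ℝ x).intervalIntegral_comp_comm (hv.intervalIntegrable _ _)).symm
    have hvx : Continuous fun t => v t x := (ContinuousMap.evalCLM ℝ x).continuous.comp hv
    have h2 : ∫ t in (0:ℝ)..w, v t x = u w x - u 0 x :=
      intervalIntegral.integral_eq_sub_of_hasDerivAt (fun t _ => h t x)
        (hvx.intervalIntegrable _ _)
    rw [ContinuousMap.add_apply, h1, h2]; ring
  have : u = fun w => u 0 + ∫ t in (0:ℝ)..w, v t := funext key
  rw [this]
  exact (intervalIntegral.integral_hasDerivAt_right (hv.intervalIntegrable _ _)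
    hv.aestronglyMeasurable.stronglyMeasurableAtFilter hv.continuousAt).const_add _

/-- composition with an affine function of `l`. -/
def comp1 (f : C(ℝ, ℝ)) (l : C(X, ℝ)) (s b : ℝ) : C(X, ℝ) := f.comp (s • l + ContinuousMap.const X b)

lemma comp1_apply (f : C(ℝ, ℝ)) (l : C(X, ℝ)) (s b : ℝ) (x : X) :
    comp1 f l s b x = f (s * l x + b) := rfl

lemma comp1_cont (f : C(ℝ, ℝ)) (l : C(X, ℝ)) :
    Continuous fun p : ℝ × ℝ => comp1 f l p.1 p.2 := by
  apply ContinuousMap.continuous_of_continuous_uncurry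
  show Continuous fun q : (ℝ × ℝ) × X => f (q.1.1 * l q.2 + q.1.2)
  fun_prop

lemma pow_mem_of_smooth (N : Submodule ℝ C(X, ℝ)) (hN : IsClosed (N : Set C(X, ℝ)))
    (l : C(X, ℝ)) (f : ℝ → ℝ) (hf : ContDiff ℝ (⊤ : ℕ∞) f)
    (hm : ∀ s b, comp1 ⟨f, hf.continuous⟩ l s b ∈ N) (k : ℕ) (b : ℝ)
    (hb : iteratedDeriv k f b ≠ 0) : l ^ k ∈ N := by
  have hcont : ∀ k, Continuous (iteratedDeriv k f) := fun k =>
    hf.continuous_iteratedDeriv k (by exact_mod_cast le_top)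
  have hd : ∀ k x, HasDerivAt (iteratedDeriv k f) (iteratedDeriv (k+1) f x) x := by
    intro k x
    rw [iteratedDeriv_succ]
    refine (hf.differentiable_iteratedDeriv k ?_ x).hasDerivAt
    exact_mod_cast WithTop.coe_lt_top k
  have main : ∀ k s b, l ^ k * comp1 ⟨iteratedDeriv k f, hcont k⟩ l s b ∈ N := by
    intro k
    induction k with
    | zero =>
      intro s b
      have : comp1 ⟨iteratedDeriv 0 f, hcont 0⟩ l s b = comp1 ⟨f, hf.continuous⟩ l s b := by
        ext x; simp [comp1_apply]
      rw [this, pow_zero, one_mul]; exact hm s b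
    | succ k ih =>
      intro s b
      refine deriv_mem_closed N hN
        (fun s => l ^ k * comp1 ⟨iteratedDeriv k f, hcont k⟩ l s b) _ s ?_ (fun t => ih t b)
      refine hasDerivAt_curve _
        (fun s => l ^ (k+1) * comp1 ⟨iteratedDeriv (k+1) f, hcont (k+1)⟩ l s b) ?_ ?_ s
      · exact continuous_const.mul
          ((comp1_cont _ l).comp (continuous_id.prodMk continuous_const))
      · intro w x
        simp only [ContinuousMap.mul_apply, ContinuousMap.pow_apply, comp1_apply,
          ContinuousMap.coe_mk]
        have h1 : HasDerivAt (fun w : ℝ => w * l x + b) (l x) w := by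
          simpa using ((hasDerivAt_id w).mul_const (l x)).add_const b
        have h2 := ((hd k (w * l x + b)).comp w h1).const_mul (l x ^ k)
        rw [show l x ^ (k+1) * iteratedDeriv (k+1) f (w * l x + b) =
          l x ^ k * (iteratedDeriv (k+1) f (w * l x + b) * l x) by ring]
        exact h2
  have := N.smul_mem (iteratedDeriv k f b)⁻¹ (main k 0 b)
  convert this using 1
  ext x
  simp [comp1_apply]
  field_simp

def polyMap (k : ℕ) : (Fin k → ℝ) →ₗ[ℝ] (ℝ → ℝ) where
  toFun c := fun x => ∑ i, c i * x ^ (i : ℕ)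
  map_add' c d := by ext x; simp [add_mul, Finset.sum_add_distrib]
  map_smul' r c := by ext x; simp [mul_assoc, Finset.mul_sum]

lemma polyMap_apply (k : ℕ) (c : Fin k → ℝ) (x : ℝ) :
    polyMap k c x = ∑ i, c i * x ^ (i : ℕ) := rfl

lemma mem_polyMap (k : ℕ) : ∀ f : ℝ → ℝ, ContDiff ℝ (⊤ : ℕ∞) f → (∀ x, iteratedDeriv k f x = 0) →
    f ∈ LinearMap.range (polyMap k) := by
  induction k with
  | zero =>
    intro f _ h
    refine ⟨0, ?_⟩
    ext x; rw [polyMap_apply]; simpa using (h x).symm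
  | succ k ih =>
    intro f hf h
    have hf' : ContDiff ℝ (⊤ : ℕ∞) (deriv f) := by
      have := (contDiff_infty_iff_deriv.1 hf).2
      exact this
    obtain ⟨c, hc⟩ := ih (deriv f) hf' (fun x => by rw [← iteratedDeriv_succ']; exact h x)
    let g : ℝ → ℝ := fun x => ∑ i : Fin k, (c i / ((i : ℕ) + 1)) * x ^ ((i : ℕ) + 1)
    have hg : ∀ x, HasDerivAt g (deriv f x) x := by
      intro x
      rw [← hc, polyMap_apply]
      refine HasDerivAt.fun_sum fun i _ => ?_
      have h0 : ((i : ℕ) : ℝ) + 1 ≠ 0 := by positivity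
      have h1 := (hasDerivAt_pow ((i : ℕ) + 1) x).const_mul (c i / ((i : ℕ) + 1))
      have h2 : c i * x ^ (i : ℕ) =
          (c i / ((i : ℕ) + 1)) * (((i : ℕ) + 1 : ℕ) * x ^ ((i : ℕ) + 1 - 1)) := by
        rw [Nat.add_sub_cancel]
        push_cast
        field_simp
      rw [h2]
      exact h1
    have hfd : ∀ x, HasDerivAt f (deriv f x) x := fun x =>
      ((hf.differentiable (by simp)) x).hasDerivAt
    have hfg : ∀ x, HasDerivAt (fun y => f y - g y) 0 x := fun x => by
      have h1 := (hfd x).sub (hg x)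
      rw [sub_self] at h1
      exact h1
    have hconst : ∀ x, f x - g x = f 0 - g 0 := fun x =>
      is_const_of_deriv_eq_zero (fun x => (hfg x).differentiableAt) (fun x => (hfg x).deriv) x 0
    refine ⟨Fin.cons (f 0 - g 0) (fun i => c i / ((i : ℕ) + 1)), ?_⟩
    ext x
    rw [polyMap_apply, Fin.sum_univ_succ]
    have := hconst x
    simp only [Fin.cons_zero, Fin.cons_succ, Fin.val_zero, pow_zero, mul_one, Fin.val_succ]
    show _ + g x = f x
    linarith

lemma pow_mem (θ : ℝ → ℝ) (hθc : Continuous θ)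
    (hθ : ¬ ∃ p : Polynomial ℝ, ∀ x : ℝ, θ x = p.eval x)
    (N : Submodule ℝ C(X, ℝ)) (hN : IsClosed (N : Set C(X, ℝ)))
    (l : C(X, ℝ)) (hm : ∀ s b, comp1 ⟨θ, hθc⟩ l s b ∈ N) (k : ℕ) : l ^ k ∈ N := by
  by_contra hk
  apply hθ
  have hsm : ∀ φ : ContDiffBump (0 : ℝ),
      ContDiff ℝ (⊤ : ℕ∞) (φ.normed volume ⋆[lsmul ℝ ℝ, volume] θ) := fun φ =>
    φ.hasCompactSupport_normed.contDiff_convolution_left _ φ.contDiff_normed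
      hθc.locallyIntegrable
  have hφ : ∀ φ : ContDiffBump (0 : ℝ),
      (φ.normed volume ⋆[lsmul ℝ ℝ, volume] θ) ∈ LinearMap.range (polyMap k) := by
    intro φ
    refine mem_polyMap k _ (hsm φ) fun b => ?_
    by_contra hb
    refine hk (pow_mem_of_smooth N hN l _ (hsm φ) ?_ k b hb)
    clear hb b
    intro s b
    have hFc : Continuous fun t : ℝ => φ.normed volume t • comp1 ⟨θ, hθc⟩ l s (b - t) :=
      φ.continuous_normed.smul ((comp1_cont _ l).comp
        (continuous_const.prodMk (continuous_const.sub continuous_id)))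
    have hFs : HasCompactSupport fun t : ℝ => φ.normed volume t • comp1 ⟨θ, hθc⟩ l s (b - t) :=
      HasCompactSupport.intro (φ.hasCompactSupport_normed (μ := volume)) fun t ht => by
        rw [image_eq_zero_of_notMem_tsupport ht, zero_smul]
    have := integral_mem_closed N hN _ hFc hFs (fun t => N.smul_mem _ (hm _ _))
    refine (congrArg (· ∈ N) ?_).mpr this
    ext x
    have h1 := (ContinuousMap.evalCLM ℝ x).integral_comp_comm (μ := volume)
      (hFc.integrable_of_hasCompactSupport hFs)
    refine Eq.trans ?_ h1
    rw [comp1_apply]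
    simp only [ContinuousMap.coe_mk, convolution_def, lsmul_apply]
    congr 1
    ext t
    show _ = φ.normed volume t • θ (s * l x + (b - t))
    rw [add_sub_assoc]
  have hcl : IsClosed ((LinearMap.range (polyMap k) : Submodule ℝ (ℝ → ℝ)) : Set (ℝ → ℝ)) :=
    Submodule.closed_of_finiteDimensional _
  let ψ : ℕ → ContDiffBump (0 : ℝ) := fun i =>
    ⟨1 / ((i : ℝ) + 1) / 2, 1 / ((i : ℝ) + 1), by positivity, half_lt_self (by positivity)⟩
  have hψ : Tendsto (fun i => (ψ i).rOut) atTop (𝓝 0) := tendsto_one_div_add_atTop_nhds_zero_nat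
  have hlim : Tendsto (fun i => ((ψ i).normed volume ⋆[lsmul ℝ ℝ, volume] θ)) atTop (𝓝 θ) :=
    tendsto_pi_nhds.2 fun x => ContDiffBump.convolution_tendsto_right_of_continuous hψ hθc x
  obtain ⟨c, hc⟩ := hcl.mem_of_tendsto hlim (Eventually.of_forall fun i => hφ (ψ i))
  refine ⟨∑ i, Polynomial.C (c i) * Polynomial.X ^ (i : ℕ), fun x => ?_⟩
  rw [← hc, polyMap_apply, Polynomial.eval_finset_sum]
  simp

lemma exp_mem (N : Submodule ℝ C(X, ℝ)) (hN : IsClosed (N : Set C(X, ℝ)))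
    (l : C(X, ℝ)) (h : ∀ k, l ^ k ∈ N) : NormedSpace.exp l ∈ N := by
  have := NormedSpace.exp_series_hasSum_exp' (𝕂 := ℝ) l
  refine hN.mem_of_tendsto this (Eventually.of_forall fun s => ?_)
  exact N.sum_mem fun i _ => N.smul_mem _ (h i)

lemma exp_apply (l : C(X, ℝ)) (x : X) : NormedSpace.exp l x = Real.exp (l x) := by
  have h1 := (NormedSpace.exp_series_hasSum_exp' (𝕂 := ℝ) l).mapL (ContinuousMap.evalCLM ℝ x)
  have h2 := NormedSpace.exp_series_hasSum_exp' (𝕂 := ℝ) (l x)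
  rw [← Real.exp_eq_exp_ℝ] at h2
  exact h1.unique h2

lemma eq_top (L : Submodule ℝ C(X, ℝ)) (hL : ∀ x y, x ≠ y → ∃ l ∈ L, l x ≠ l y)
    (N : Submodule ℝ C(X, ℝ)) (hN : IsClosed (N : Set C(X, ℝ)))
    (h : ∀ l ∈ L, NormedSpace.exp l ∈ N) (f : C(X, ℝ)) : f ∈ N := by
  let M : Submonoid C(X, ℝ) :=
    { carrier := {g | ∃ l ∈ L, NormedSpace.exp l = g}
      one_mem' := ⟨0, L.zero_mem, NormedSpace.exp_zero⟩
      mul_mem' := by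
        rintro _ _ ⟨l, hl, rfl⟩ ⟨l', hl', rfl⟩
        refine ⟨l + l', L.add_mem hl hl', ?_⟩
        ext x
        simp [exp_apply, Real.exp_add] }
  let A : Subalgebra ℝ C(X, ℝ) := Algebra.adjoin ℝ (M : Set C(X, ℝ))
  have hA : ∀ g ∈ A, g ∈ N := by
    intro g hg
    have h1 : g ∈ Subalgebra.toSubmodule A := hg
    rw [Algebra.adjoin_eq_span, Submonoid.closure_eq] at h1
    refine Submodule.span_le.2 ?_ h1
    rintro _ ⟨l, hl, rfl⟩
    exact h l hl
  have hsep : A.SeparatesPoints := by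
    intro x y hxy
    obtain ⟨l, hl, hne⟩ := hL x y hxy
    refine ⟨_, ⟨NormedSpace.exp l, Algebra.subset_adjoin ⟨l, hl, rfl⟩, rfl⟩, ?_⟩
    show NormedSpace.exp l x ≠ NormedSpace.exp l y
    rw [exp_apply, exp_apply]
    exact fun he => hne (Real.exp_injective he)
  have htop := ContinuousMap.subalgebra_topologicalClosure_eq_top_of_separatesPoints A hsep
  have hf : f ∈ A.topologicalClosure := by rw [htop]; trivial
  exact closure_minimal (fun g hg => hA g hg) hN hf

end UAT

theorem universal_approximation_one_layer
    (θ : ℝ → ℝ) (hθc : Continuous θ)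
    (hθ : ¬ ∃ p : Polynomial ℝ, ∀ x : ℝ, θ x = p.eval x)
    (n m : ℕ) (K : Set (EuclideanSpace ℝ (Fin n))) (hK : IsCompact K)
    (h : EuclideanSpace ℝ (Fin n) → EuclideanSpace ℝ (Fin m))
    (hh : ContinuousOn h K) (ε : ℝ) (hε : 0 < ε) :
    ∃ (k : ℕ) (A : Matrix (Fin k) (Fin n) ℝ) (a : Fin k → ℝ)
      (B : Matrix (Fin m) (Fin k) ℝ),
      ∀ u ∈ K,
        ‖h u - (WithLp.equiv 2 (Fin m → ℝ)).symm
            (B.mulVec fun j => θ ((A.mulVec (WithLp.equiv 2 (Fin n → ℝ) u)) j + a j))‖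
          < ε := by
  have : CompactSpace K := isCompact_iff_compactSpace.1 hK
  let lin : (Fin n → ℝ) →ₗ[ℝ] C(K, ℝ) :=
    { toFun := fun w => ⟨fun u => ∑ i, w i * u.1 i, by fun_prop⟩
      map_add' := fun w w' => by ext u; simp [add_mul, Finset.sum_add_distrib]
      map_smul' := fun r w => by ext u; simp [mul_assoc, Finset.mul_sum] }
  have lin_apply : ∀ w (u : K), lin w u = ∑ i, w i * u.1 i := fun _ _ => rfl
  let neu : (Fin n → ℝ) × ℝ → C(K, ℝ) := fun p => UAT.comp1 ⟨θ, hθc⟩ (lin p.1) 1 p.2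
  let S : Submodule ℝ C(K, ℝ) := Submodule.span ℝ (Set.range neu)
  have hall : ∀ f : C(K, ℝ), f ∈ S.topologicalClosure := by
    intro f
    refine UAT.eq_top (LinearMap.range lin) ?_ _ S.isClosed_topologicalClosure ?_ f
    · intro x y hxy
      have : ∃ i, x.1 i ≠ y.1 i := by
        by_contra! hc
        exact hxy (Subtype.ext (PiLp.ext hc))
      obtain ⟨i, hi⟩ := this
      refine ⟨_, ⟨Pi.single i 1, rfl⟩, ?_⟩
      simpa [lin_apply, Pi.single_apply] using hi
    · rintro _ ⟨w, rfl⟩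
      refine UAT.exp_mem _ S.isClosed_topologicalClosure _ fun k => ?_
      refine UAT.pow_mem θ hθc hθ _ S.isClosed_topologicalClosure _ ?_ k
      intro s b
      apply S.le_topologicalClosure
      apply Submodule.subset_span
      refine ⟨(s • w, b), ?_⟩
      ext u
      simp [neu, UAT.comp1_apply]
  have hδ : 0 < ε / (m + 1) := by positivity
  have happ : ∀ i : Fin m, ∃ c : ((Fin n → ℝ) × ℝ) →₀ ℝ, ∀ u : K,
      |h u.1 i - c.sum (fun p r => r * neu p u)| < ε / (m + 1) := by
    intro i
    let f : C(K, ℝ) := ⟨fun u => h u.1 i, by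
      have := continuousOn_iff_continuous_domRestrict.1 hh
      exact (EuclideanSpace.proj (𝕜 := ℝ) i).continuous.comp this⟩
    obtain ⟨g, hg, hfg⟩ := Metric.mem_closure_iff.1 (hall f) _ hδ
    obtain ⟨c, hc⟩ := Finsupp.mem_span_range_iff_exists_finsupp.1 hg
    refine ⟨c, fun u => ?_⟩
    have h1 := ContinuousMap.dist_lt_iff hδ |>.1 hfg u
    rw [Real.dist_eq] at h1
    have h2 : g u = c.sum (fun p r => r * neu p u) := by
      rw [← hc]
      simp [Finsupp.sum, ContinuousMap.sum_apply]
    rw [← h2]; exact h1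
  choose c hc using happ
  classical
  let s : Finset ((Fin n → ℝ) × ℝ) := Finset.univ.biUnion fun i => (c i).support
  let e := s.equivFin
  refine ⟨s.card, fun j => (e.symm j).1.1, fun j => (e.symm j).1.2, fun i j => c i (e.symm j).1, ?_⟩
  intro u hu
  have hcoord : ∀ i, |(h u - (WithLp.equiv 2 (Fin m → ℝ)).symm
      (Matrix.mulVec (fun i j => c i (e.symm j).1 : Matrix (Fin m) (Fin s.card) ℝ) fun j =>
        θ ((Matrix.mulVec (fun j => (e.symm j).1.1 : Matrix (Fin s.card) (Fin n) ℝ)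
          (WithLp.equiv 2 (Fin n → ℝ) u)) j + (e.symm j).1.2))) i| < ε / (m + 1) := by
    intro i
    have h1 := hc i ⟨u, hu⟩
    have h2 : (c i).sum (fun p r => r * neu p ⟨u, hu⟩) =
        ∑ j, c i (e.symm j).1 * neu (e.symm j).1 ⟨u, hu⟩ := by
      rw [Finsupp.sum_of_support_subset (s := s) _
        (Finset.subset_biUnion_of_mem (fun i => (c i).support) (Finset.mem_univ i)) _ (by simp)]
      rw [← Finset.sum_coe_sort s]
      exact (Equiv.sum_comp e.symm fun p : s => c i p.1 * neu p.1 ⟨u, hu⟩).symm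
    rw [h2] at h1
    refine lt_of_eq_of_lt (congrArg abs ?_) h1
    refine congrArg (h u i - ·) ?_
    show _ = ∑ j, c i (e.symm j).1 * θ (1 * (∑ l, (e.symm j).1.1 l * u l) + (e.symm j).1.2)
    simp only [one_mul]
    rfl
  revert hcoord
  generalize (h u - (WithLp.equiv 2 (Fin m → ℝ)).symm
      (Matrix.mulVec (fun i j => c i (e.symm j).1 : Matrix (Fin m) (Fin s.card) ℝ) fun j =>
        θ ((Matrix.mulVec (fun j => (e.symm j).1.1 : Matrix (Fin s.card) (Fin n) ℝ)
          (WithLp.equiv 2 (Fin n → ℝ) u)) j + (e.symm j).1.2))) = v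
  intro hv
  rw [EuclideanSpace.norm_eq, Real.sqrt_lt' hε]
  have h3 : ∑ i, ‖v i‖ ^ 2 ≤ ∑ _i : Fin m, (ε / (m + 1)) ^ 2 :=
    Finset.sum_le_sum fun i _ => by
      rw [Real.norm_eq_abs]
      exact pow_le_pow_left₀ (abs_nonneg _) (hv i).le 2
  refine h3.trans_lt ?_
  rw [Finset.sum_const, Finset.card_univ, Fintype.card_fin, nsmul_eq_mul, div_pow,
    mul_div_assoc', div_lt_iff₀ (by positivity), mul_comm]
  have : (0:ℝ) ≤ m := Nat.cast_nonneg m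
  have hm : (m : ℝ) < (m + 1) ^ 2 := by nlinarith
  exact mul_lt_mul_of_pos_left hm (by positivity)
end

section
/- Let u : ℝ → ℝ be continuously differentiable on [0,1] and let n ≥ 1 be an integer. Then the series ∑_{k=n+1}^∞ (∫_0^1 u(x)·√2·cos(kπx) dx)² converges and satisfies ∑_{k=n+1}^∞ (∫_0^1 u(x)·√2·cos(kπx) dx)² ≤ (1/(π² n²)) ∫_0^1 (u'(x))² dx. -/
open MeasureTheory intervalIntegral in
lemma aux_bessel (g : ℝ → ℝ) (hg : ContinuousOn g (Set.Icc 0 1)) (s : ℕ → ℝ → ℝ)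
    (hs : ∀ k, Continuous (s k))
    (ho : ∀ i j, (∫ x in (0:ℝ)..1, s i x * s j x) = if i = j then 1 else 0) (N : ℕ) :
    ∑ k ∈ Finset.range N, (∫ x in (0:ℝ)..1, g x * s k x) ^ 2 ≤ ∫ x in (0:ℝ)..1, (g x) ^ 2 := by
  have hg' : ContinuousOn g (Set.uIcc 0 1) := by rwa [Set.uIcc_of_le zero_le_one]
  set b : ℕ → ℝ := fun k => ∫ x in (0:ℝ)..1, g x * s k x with hb
  let S : ℝ → ℝ := fun x => ∑ k ∈ Finset.range N, b k * s k x
  have hS : Continuous S := by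
    apply continuous_finset_sum
    intro k _
    exact continuous_const.mul (hs k)
  have h0 : 0 ≤ ∫ x in (0:ℝ)..1, (g x - S x) ^ 2 :=
    intervalIntegral.integral_nonneg zero_le_one (fun x _ => sq_nonneg _)
  have h1 : (∫ x in (0:ℝ)..1, (g x - S x) ^ 2) =
      (∫ x in (0:ℝ)..1, (g x)^2) - 2 * (∫ x in (0:ℝ)..1, g x * S x)
        + ∫ x in (0:ℝ)..1, S x * S x := by
    rw [← intervalIntegral.integral_const_mul, ← intervalIntegral.integral_sub,
      ← intervalIntegral.integral_add]
    · congr 1; ext x; ring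
    · exact ((hg'.pow 2).sub (continuousOn_const.mul (hg'.mul hS.continuousOn))).intervalIntegrable
    · exact (hS.mul hS).intervalIntegrable _ _
    · exact (hg'.pow 2).intervalIntegrable
    · exact (continuousOn_const.mul (hg'.mul hS.continuousOn)).intervalIntegrable
  have h2 : (∫ x in (0:ℝ)..1, g x * S x) = ∑ k ∈ Finset.range N, b k ^ 2 := by
    have : ∀ x, g x * S x = ∑ k ∈ Finset.range N, b k * (g x * s k x) := by
      intro x
      simp only [S, Finset.mul_sum]
      exact Finset.sum_congr rfl (fun k _ => by ring)
    simp_rw [this]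
    rw [intervalIntegral.integral_finset_sum]
    · refine Finset.sum_congr rfl (fun k _ => ?_)
      rw [intervalIntegral.integral_const_mul, sq]
    · intro k _
      exact (continuousOn_const.mul (hg'.mul (hs k).continuousOn)).intervalIntegrable
  have h3 : (∫ x in (0:ℝ)..1, S x * S x) = ∑ k ∈ Finset.range N, b k ^ 2 := by
    have : ∀ x, S x * S x = ∑ k ∈ Finset.range N, ∑ j ∈ Finset.range N,
        (b k * b j) * (s k x * s j x) := by
      intro x
      simp only [S, Finset.sum_mul_sum]
      exact Finset.sum_congr rfl (fun k _ => Finset.sum_congr rfl (fun j _ => by ring))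
    simp_rw [this]
    rw [intervalIntegral.integral_finset_sum]
    · refine Finset.sum_congr rfl (fun k hk => ?_)
      rw [intervalIntegral.integral_finset_sum]
      · simp_rw [intervalIntegral.integral_const_mul, ho]
        simp only [mul_ite, mul_one, mul_zero, Finset.sum_ite_eq, hk, if_true, sq]
      · intro j _
        exact (continuous_const.mul ((hs k).mul (hs j))).intervalIntegrable _ _
    · intro k _
      exact (continuous_finset_sum _ (fun j _ =>
        continuous_const.mul ((hs k).mul (hs j)))).intervalIntegrable _ _
  rw [h1, h2, h3] at h0
  linarith

lemma aux_cos (m : ℤ) (hm : m ≠ 0) : (∫ x in (0:ℝ)..1, Real.cos ((m:ℝ) * Real.pi * x)) = 0 := by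
  have hc : (m:ℝ) * Real.pi ≠ 0 := mul_ne_zero (by exact_mod_cast hm) Real.pi_ne_zero
  rw [intervalIntegral.integral_comp_mul_left (fun x => Real.cos x) hc]
  simp [integral_cos, Real.sin_int_mul_pi]

lemma aux_orth (n i j : ℕ) :
    (∫ x in (0:ℝ)..1, (Real.sqrt 2 * Real.sin (((n:ℝ) + 1 + (i:ℝ)) * Real.pi * x)) *
      (Real.sqrt 2 * Real.sin (((n:ℝ) + 1 + (j:ℝ)) * Real.pi * x))) = if i = j then 1 else 0 := by
  have h2 : Real.sqrt 2 * Real.sqrt 2 = 2 := Real.mul_self_sqrt (by norm_num)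
  have : ∀ x : ℝ, (Real.sqrt 2 * Real.sin (((n:ℝ) + 1 + (i:ℝ)) * Real.pi * x)) *
      (Real.sqrt 2 * Real.sin (((n:ℝ) + 1 + (j:ℝ)) * Real.pi * x)) =
      Real.cos ((((i:ℤ) - (j:ℤ) : ℤ):ℝ) * Real.pi * x) -
      Real.cos (((2 * (n:ℤ) + 2 + i + j : ℤ) : ℝ) * Real.pi * x) := by
    intro x
    have e1 : (((i:ℤ) - (j:ℤ) : ℤ):ℝ) * Real.pi * x = ((n:ℝ) + 1 + (i:ℝ)) * Real.pi * x -
      ((n:ℝ) + 1 + (j:ℝ)) * Real.pi * x := by push_cast; ring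
    have e2 : ((2 * (n:ℤ) + 2 + i + j : ℤ) : ℝ) * Real.pi * x = ((n:ℝ) + 1 + (i:ℝ)) * Real.pi * x +
      ((n:ℝ) + 1 + (j:ℝ)) * Real.pi * x := by push_cast; ring
    rw [e1, e2, Real.cos_sub, Real.cos_add]
    linear_combination (Real.sin (((n:ℝ) + 1 + (i:ℝ)) * Real.pi * x) *
      Real.sin (((n:ℝ) + 1 + (j:ℝ)) * Real.pi * x)) * h2
  simp_rw [this]
  rw [intervalIntegral.integral_sub
    (Continuous.intervalIntegrable (by fun_prop) _ _)
    (Continuous.intervalIntegrable (by fun_prop) _ _), aux_cos (2 * (n:ℤ) + 2 + i + j) (by omega)]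
  split_ifs with h
  · subst h; simp
  · rw [aux_cos _ (by omega)]; simp

lemma aux_ibp (u u' : ℝ → ℝ)
    (hu : ∀ x ∈ Set.Icc (0 : ℝ) 1, HasDerivWithinAt u (u' x) (Set.Icc 0 1) x)
    (hu' : ContinuousOn u' (Set.Icc 0 1)) (m : ℕ) (hm : m ≠ 0) :
    (∫ x in (0:ℝ)..1, u x * (Real.sqrt 2 * Real.cos ((m:ℝ) * Real.pi * x))) =
      - (1 / (m * Real.pi)) *
        ∫ x in (0:ℝ)..1, u' x * (Real.sqrt 2 * Real.sin ((m:ℝ) * Real.pi * x)) := by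
  have hc : (m:ℝ) * Real.pi ≠ 0 := mul_ne_zero (by exact_mod_cast hm) Real.pi_ne_zero
  have hu0 : ∀ x ∈ Set.uIcc (0 : ℝ) 1, HasDerivWithinAt u (u' x) (Set.uIcc 0 1) x := by
    rwa [Set.uIcc_of_le zero_le_one]
  have hu1 : ContinuousOn u' (Set.uIcc 0 1) := by rwa [Set.uIcc_of_le zero_le_one]
  have hv : ∀ x ∈ Set.uIcc (0 : ℝ) 1, HasDerivWithinAt
      (fun x => (1 / (m * Real.pi)) * (Real.sqrt 2 * Real.sin ((m:ℝ) * Real.pi * x)))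
      (Real.sqrt 2 * Real.cos ((m:ℝ) * Real.pi * x)) (Set.uIcc 0 1) x := by
    intro x _
    have h := ((((hasDerivAt_id x).const_mul ((m:ℝ) * Real.pi)).sin).const_mul
      (Real.sqrt 2)).const_mul (1 / (m * Real.pi))
    refine (h.congr_deriv ?_).hasDerivWithinAt
    simp only [id]
    field_simp
  have key := intervalIntegral.integral_mul_deriv_eq_deriv_mul_of_hasDerivWithinAt hu0 hv
    hu1.intervalIntegrable (Continuous.intervalIntegrable (by fun_prop) _ _)
  rw [key]
  simp only [mul_one, mul_zero, Real.sin_zero, Real.sin_nat_mul_pi, zero_sub, sub_zero]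
  rw [neg_mul, ← intervalIntegral.integral_const_mul]
  congr 2; ext x; ring

/-- **Projection error estimate for the cosine basis.** If `u` is continuously
differentiable on `[0,1]` (with derivative `u'`) and `n ≥ 1`, then the tail of
the squared cosine Fourier coefficients of `u` converges and satisfies
`∑_{k=n+1}^∞ (∫₀¹ u(x) √2 cos(kπx) dx)² ≤ (1/(π²n²)) ∫₀¹ (u'(x))² dx`. -/
theorem cosine_tail_projection_error
    (u u' : ℝ → ℝ)
    (hu : ∀ x ∈ Set.Icc (0 : ℝ) 1, HasDerivWithinAt u (u' x) (Set.Icc 0 1) x)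
    (hu' : ContinuousOn u' (Set.Icc 0 1))
    (n : ℕ) (hn : 1 ≤ n) :
    Summable (fun k : ℕ =>
      (∫ x in (0 : ℝ)..1,
          u x * (Real.sqrt 2 * Real.cos (((n : ℝ) + 1 + (k : ℝ)) * Real.pi * x))) ^ 2) ∧
    (∑' k : ℕ,
        (∫ x in (0 : ℝ)..1,
            u x * (Real.sqrt 2 * Real.cos (((n : ℝ) + 1 + (k : ℝ)) * Real.pi * x))) ^ 2)
      ≤ (1 / (Real.pi ^ 2 * (n : ℝ) ^ 2)) * ∫ x in (0 : ℝ)..1, (u' x) ^ 2 := by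
  have hn0 : (0:ℝ) < n := by exact_mod_cast hn
  have hpi := Real.pi_pos
  set a : ℕ → ℝ := fun k => (∫ x in (0 : ℝ)..1,
          u x * (Real.sqrt 2 * Real.cos (((n : ℝ) + 1 + (k : ℝ)) * Real.pi * x))) ^ 2 with ha
  have hle : ∀ k, a k ≤ (1 / (Real.pi ^ 2 * (n : ℝ) ^ 2)) * (∫ x in (0 : ℝ)..1,
      u' x * (Real.sqrt 2 * Real.sin (((n : ℝ) + 1 + (k : ℝ)) * Real.pi * x))) ^ 2 := by
    intro k
    have h := aux_ibp u u' hu hu' (n + 1 + k) (by omega)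
    push_cast at h
    simp only [ha]
    rw [h, mul_pow]
    apply mul_le_mul_of_nonneg_right _ (sq_nonneg _)
    rw [neg_sq, div_pow, one_pow, mul_pow, mul_comm (Real.pi ^ 2)]
    have hk : (0:ℝ) ≤ k := Nat.cast_nonneg k
    have : (n:ℝ) ≤ n + 1 + k := by linarith
    gcongr
  have hb : ∀ N, ∑ k ∈ Finset.range N, a k ≤
      (1 / (Real.pi ^ 2 * (n : ℝ) ^ 2)) * ∫ x in (0 : ℝ)..1, (u' x) ^ 2 := by
    intro N
    refine (Finset.sum_le_sum (fun k _ => hle k)).trans ?_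
    rw [← Finset.mul_sum]
    apply mul_le_mul_of_nonneg_left _ (by positivity)
    exact aux_bessel u' hu' (fun k x => Real.sqrt 2 *
      Real.sin (((n : ℝ) + 1 + (k : ℝ)) * Real.pi * x)) (fun k => by fun_prop)
      (fun i j => aux_orth n i j) N
  have ha0 : ∀ k, 0 ≤ a k := fun k => sq_nonneg _
  exact ⟨summable_of_sum_range_le ha0 hb, Real.tsum_le_of_sum_range_le ha0 hb⟩
end

section
/- Let θ : ℝ → ℝ be continuous and not a polynomial (i.e., there is no polynomial p with θ(x) = p(x) for all x ∈ ℝ). Let n ∈ ℕ, T > 0, and let g : [0,T] × ℝⁿ → ℝⁿ be continuous with |g(t,u)| ≤ C(1 + |u|) for all (t,u) ∈ [0,T] × ℝⁿ, for some C > 0. Then there exists a sequence of functions G_m : [0,T] × ℝⁿ → ℝⁿ, each of the form G_m(t,u) = B_m·θ(A_m·(t, η^{l_m}(u))ᵀ + a_m) for some k_m, l_m ∈ ℕ, A_m ∈ ℝ^{k_m×(n+1)}, a_m ∈ ℝ^{k_m}, B_m ∈ ℝ^{n×k_m} (a one-layer artificial neural network precomposed with a radial truncation), such that |G_m(t,u)|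 ≤ (C+1)(1 + |u|) for all m and all (t,u) ∈ [0,T] × ℝⁿ, and such that for every R > 0, sup_{t ∈ [0,T], |u| ≤ R} |G_m(t,u) − g(t,u)| → 0 as m → ∞. -/
/-- The radial truncation at level `m`: `η^m(x) = x` if `|x| ≤ m` and
`η^m(x) = m·x/|x|` if `|x| > m`, where `|·|` is the Euclidean norm on `ℝⁿ`. -/
noncomputable def radialTrunc (n : ℕ) (m : ℝ) (x : EuclideanSpace ℝ (Fin n)) :
    EuclideanSpace ℝ (Fin n) :=
  if ‖x‖ ≤ m then x else (m / ‖x‖) • x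


lemma nn_grid_poly (θ : ℝ → ℝ) (k : ℕ) (y h : ℝ) (hh : h ≠ 0)
    (H : ∀ x, (fwdDiff h)^[k] θ x = 0) :
    ∃ p : Polynomial ℝ, ∀ N : ℕ, θ (y + N * h) = p.eval (y + N * h) := by
  have Hz : ∀ j, k ≤ j → ∀ x, (fwdDiff h)^[j] θ x = 0 := by
    intro j hj
    induction j, hj using Nat.le_induction with
    | base => exact H
    | succ j _ ih =>
      intro x
      rw [Function.iterate_succ_apply']
      simp [fwdDiff, ih]
  let q : Polynomial ℝ := ∑ j ∈ Finset.range k,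
    Polynomial.C ((fwdDiff h)^[j] θ y / (j.factorial : ℝ)) * descPochhammer ℝ j
  refine ⟨q.comp (Polynomial.C h⁻¹ * (Polynomial.X - Polynomial.C y)), fun N => ?_⟩
  have e1 : (q.comp (Polynomial.C h⁻¹ * (Polynomial.X - Polynomial.C y))).eval (y + N * h)
      = q.eval (N : ℝ) := by
    simp only [Polynomial.eval_comp, Polynomial.eval_mul, Polynomial.eval_C, Polynomial.eval_sub,
      Polynomial.eval_X]
    congr 1
    field_simp
    ring
  have e2 := shift_eq_sum_fwdDiff_iter h θ N y
  rw [nsmul_eq_mul] at e2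
  rw [e1, e2]
  have e3 : ∀ j, (N.choose j • (fwdDiff h)^[j] θ y : ℝ) =
      (Polynomial.C ((fwdDiff h)^[j] θ y / (j.factorial : ℝ)) * descPochhammer ℝ j).eval (N:ℝ) := by
    intro j
    have hf : (j.factorial : ℝ) ≠ 0 := by positivity
    rw [Polynomial.eval_mul, Polynomial.eval_C, descPochhammer_eval_eq_descFactorial,
      Nat.descFactorial_eq_factorial_mul_choose, nsmul_eq_mul]
    push_cast
    field_simp
  simp only [q, Polynomial.eval_finsetSum, ← e3]
  refine (Finset.sum_subset (Finset.range_subset_range.2 (le_max_left (N+1) k)) ?_).trans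
    (Finset.sum_subset (Finset.range_subset_range.2 (le_max_right (N+1) k)) ?_).symm
  · intro x _ hx
    rw [Nat.choose_eq_zero_of_lt (by simpa [Nat.succ_le_iff] using hx), zero_smul]
  · intro x _ hx
    rw [Hz x (by simpa using hx), smul_zero]

lemma nn_frechet (θ : ℝ → ℝ) (hθ : Continuous θ) (k : ℕ)
    (H : ∀ h x, (fwdDiff h)^[k] θ x = 0) :
    ∃ p : Polynomial ℝ, ∀ x : ℝ, θ x = p.eval x := by
  obtain ⟨p, hp⟩ := nn_grid_poly θ k 0 1 one_ne_zero (H 1)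
  refine ⟨p, fun x => congrFun (Rat.denseRange_cast.equalizer hθ p.continuous ?_) x⟩
  funext r
  have hd : (r.den : ℝ) ≠ 0 := by exact_mod_cast r.den_ne_zero
  obtain ⟨q, hq⟩ := nn_grid_poly θ k (r:ℝ) (1 / (r.den : ℝ)) (by positivity) (H _)
  have hqp : q = p := by
    apply Polynomial.eq_of_infinite_eval_eq
    have hinj : Function.Injective (fun M : ℕ => ((M + r.num.natAbs : ℕ) : ℝ)) := by
      intro a b hab
      simpa using hab
    refine (Set.infinite_range_of_injective hinj).mono ?_
    rintro _ ⟨M, rfl⟩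
    have hnn : (0:ℤ) ≤ ((M + r.num.natAbs : ℕ) : ℤ) * r.den - r.num := by
      have h1 : r.num ≤ |r.num| := le_abs_self _
      have h2 : (1:ℤ) ≤ r.den := by exact_mod_cast r.den_pos
      have h3 : 0 ≤ |r.num| := abs_nonneg _
      push_cast
      nlinarith [Int.natCast_nonneg M]
    obtain ⟨j, hj⟩ := Int.eq_ofNat_of_zero_le hnn
    have hj' : ((M + r.num.natAbs : ℕ) : ℝ) * r.den - r.num = (j : ℝ) := by
      have key : ∀ K : ℕ, (K:ℤ) * r.den - r.num = (j:ℤ) → (K:ℝ) * r.den - r.num = (j:ℝ) := by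
        intro K h
        exact_mod_cast congrArg (Int.cast : ℤ → ℝ) h
      exact key _ hj
    have hr : (r : ℝ) = r.num / r.den := by
      exact_mod_cast congrArg (fun z : ℚ => (z : ℝ)) (Rat.num_div_den r).symm
    have hx : ((M + r.num.natAbs : ℕ) : ℝ) = (r:ℝ) + j * (1 / (r.den:ℝ)) := by
      rw [← hj', hr]; field_simp; ring
    have h1 := hq j
    have h2 := hp (M + r.num.natAbs)
    rw [← hx] at h1
    rw [zero_add, mul_one] at h2
    exact h1.symm.trans h2
  have := hq 0
  simpa [hqp] using this

lemma nn_step {K : Type*} [TopologicalSpace K] [CompactSpace K] (L : C(K, ℝ) →L[ℝ] ℝ)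
    (ℓ : C(K, ℝ)) (j : ℕ) (f : C(ℝ, ℝ))
    (H : ∀ w b : ℝ, L (ℓ ^ j * f.comp (w • ℓ + b • 1)) = 0) (h w b : ℝ) :
    L (ℓ ^ (j + 1) * (f.comp (w • ℓ + (b + h) • 1) - f.comp (w • ℓ + b • 1))) = 0 := by
  have hD : Continuous (fun p : ℝ × ℝ => f.comp (p.1 • ℓ + p.2 • (1 : C(K, ℝ)))) :=
    (ContinuousMap.continuous_postcomp f).comp (by fun_prop)
  have c1 : Continuous (fun w : ℝ =>
      ℓ ^ (j + 1) * (f.comp (w • ℓ + (b + h) • 1) - f.comp (w • ℓ + b • 1))) := by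
    have h1 : Continuous (fun w : ℝ => f.comp (w • ℓ + (b + h) • (1 : C(K, ℝ)))) :=
      hD.comp (by fun_prop : Continuous (fun w : ℝ => (w, b + h)))
    have h2 : Continuous (fun w : ℝ => f.comp (w • ℓ + b • (1 : C(K, ℝ)))) :=
      hD.comp (by fun_prop : Continuous (fun w : ℝ => (w, b)))
    exact continuous_const.mul (h1.sub h2)
  have c2 : ∀ w₁ : ℝ, Continuous (fun s : ℝ =>
      ℓ ^ j * f.comp (w₁ • ℓ + (b + s) • 1) - ℓ ^ j * f.comp ((0 : ℝ) • ℓ + (b + s) • 1)) := by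
    intro w₁
    have h1 : Continuous (fun s : ℝ => f.comp (w₁ • ℓ + (b + s) • (1 : C(K, ℝ)))) :=
      hD.comp (by fun_prop : Continuous (fun s : ℝ => (w₁, b + s)))
    have h2 : Continuous (fun s : ℝ => f.comp ((0:ℝ) • ℓ + (b + s) • (1 : C(K, ℝ)))) :=
      hD.comp (by fun_prop : Continuous (fun s : ℝ => ((0:ℝ), b + s)))
    exact (continuous_const.mul h1).sub (continuous_const.mul h2)
  have key : ∀ w₁ : ℝ,
      (∫ w in (0:ℝ)..w₁,
        ℓ ^ (j + 1) * (f.comp (w • ℓ + (b + h) • 1) - f.comp (w • ℓ + b • 1))) =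
      ∫ s in (0:ℝ)..h,
        (ℓ ^ j * f.comp (w₁ • ℓ + (b + s) • 1) - ℓ ^ j * f.comp ((0:ℝ) • ℓ + (b + s) • 1)) := by
    intro w₁
    ext x
    have e1 := (ContinuousMap.evalCLM ℝ x).intervalIntegral_comp_comm
      (c1.intervalIntegrable (μ := MeasureTheory.volume) 0 w₁)
    have e2 := (ContinuousMap.evalCLM ℝ x).intervalIntegral_comp_comm
      ((c2 w₁).intervalIntegrable (μ := MeasureTheory.volume) 0 h)
    simp only [ContinuousMap.evalCLM_apply] at e1 e2
    rw [← e1, ← e2]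
    simp only [ContinuousMap.mul_apply, ContinuousMap.sub_apply, ContinuousMap.pow_apply,
      ContinuousMap.comp_apply, ContinuousMap.add_apply, ContinuousMap.smul_apply,
      ContinuousMap.one_apply, smul_eq_mul, mul_one]
    generalize ℓ x = y
    have hF : ∀ t, HasDerivAt (fun t => ∫ s in (0:ℝ)..t, f s) (f t) t := fun t =>
      intervalIntegral.integral_hasDerivAt_right (f.continuous.intervalIntegrable _ _)
        (f.continuous.stronglyMeasurableAtFilter _ _) f.continuous.continuousAt
    generalize (fun t => ∫ s in (0:ℝ)..t, f s) = F at hF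
    have d1 : ∀ c w : ℝ, HasDerivAt (fun w => F (w * y + c)) (f (w * y + c) * y) w := by
      intro c w
      have : HasDerivAt (fun w => w * y + c) y w := by
        simpa using ((hasDerivAt_id w).mul_const y).add_const c
      exact (hF _).comp w this
    have d2 : ∀ c s : ℝ, HasDerivAt (fun s => F (c + (b + s))) (f (c + (b + s))) s := by
      intro c s
      have : HasDerivAt (fun s => c + (b + s)) 1 s := by
        simpa using ((hasDerivAt_id s).const_add b).const_add c
      exact ((hF _).comp s this).congr_deriv (mul_one _)
    rw [intervalIntegral.integral_eq_sub_of_hasDerivAt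
      (f := fun w => y ^ j * (F (w * y + (b + h)) - F (w * y + b))),
      intervalIntegral.integral_eq_sub_of_hasDerivAt
      (f := fun s => y ^ j * F (w₁ * y + (b + s)) - y ^ j * F (0 * y + (b + s)))]
    · simp only [add_zero]; ring
    · intro s _
      exact ((d2 _ s).const_mul _).sub ((d2 _ s).const_mul _)
    · exact Continuous.intervalIntegrable (by fun_prop) _ _
    · intro w _
      exact (((d1 (b + h) w).sub (d1 b w)).const_mul (y ^ j)).congr_deriv (by ring)
    · exact Continuous.intervalIntegrable (by fun_prop) _ _
  set φ : ℝ → ℝ := fun w =>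
    L (ℓ ^ (j + 1) * (f.comp (w • ℓ + (b + h) • 1) - f.comp (w • ℓ + b • 1))) with hφ
  have cφ : Continuous φ := L.continuous.comp c1
  have hz : ∀ w₁, ∫ w in (0:ℝ)..w₁, φ w = 0 := by
    intro w₁
    have e1 := L.intervalIntegral_comp_comm
      (c1.intervalIntegrable (μ := MeasureTheory.volume) 0 w₁)
    have e2 := L.intervalIntegral_comp_comm
      ((c2 w₁).intervalIntegrable (μ := MeasureTheory.volume) 0 h)
    simp only [hφ]
    rw [e1, key, ← e2]
    simp only [map_sub, H, sub_zero, intervalIntegral.integral_zero]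
  have := cφ.deriv_integral φ 0 w
  simp only [hz, deriv_const] at this
  exact this.symm

lemma nn_pow {K : Type*} [TopologicalSpace K] [CompactSpace K] (L : C(K, ℝ) →L[ℝ] ℝ)
    (ℓ : C(K, ℝ)) (θ : C(ℝ, ℝ))
    (H : ∀ w b : ℝ, L (θ.comp (w • ℓ + b • 1)) = 0) (h : ℝ) (j : ℕ) :
    ∃ f : C(ℝ, ℝ), (∀ x, f x = (fwdDiff h)^[j] θ x) ∧
      ∀ w b : ℝ, L (ℓ ^ j * f.comp (w • ℓ + b • 1)) = 0 := by
  induction j with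
  | zero => exact ⟨θ, fun _ => rfl, by simpa using H⟩
  | succ j ih =>
    obtain ⟨f, hf, hL⟩ := ih
    refine ⟨⟨fun x => f (x + h) - f x, by fun_prop⟩, ?_, ?_⟩
    · intro x
      rw [Function.iterate_succ_apply']
      simp [fwdDiff, hf]
    · intro w b
      have := nn_step L ℓ j f hL h w b
      convert this using 3
      ext x
      simp [add_assoc]

lemma nn_pow_zero {K : Type*} [TopologicalSpace K] [CompactSpace K] (L : C(K, ℝ) →L[ℝ] ℝ)
    (ℓ : C(K, ℝ)) (θ : C(ℝ, ℝ))
    (H : ∀ w b : ℝ, L (θ.comp (w • ℓ + b • 1)) = 0) (j : ℕ)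
    (hj : ∃ h x, (fwdDiff h)^[j] θ x ≠ 0) : L (ℓ ^ j) = 0 := by
  obtain ⟨h, x, hx⟩ := hj
  obtain ⟨f, hf, hL⟩ := nn_pow L ℓ θ H h j
  have h1 := hL 0 x
  have e : ℓ ^ j * f.comp ((0:ℝ) • ℓ + x • 1) = f x • ℓ ^ j := by
    ext z; simp [mul_comm]
  rw [e, map_smul, hf, smul_eq_mul] at h1
  exact (mul_eq_zero.1 h1).resolve_left hx

lemma nn_exp_zero {K : Type*} [TopologicalSpace K] [CompactSpace K] (L : C(K, ℝ) →L[ℝ] ℝ)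
    (ℓ : C(K, ℝ)) (H : ∀ j : ℕ, L (ℓ ^ j) = 0) : L (NormedSpace.exp ℓ) = 0 := by
  have := (NormedSpace.exp_series_hasSum_exp' (𝕂 := ℝ) ℓ).mapL L
  simp only [map_smul, H, smul_zero] at this
  exact this.unique hasSum_zero

lemma nn_exp_apply {K : Type*} [TopologicalSpace K] [CompactSpace K]
    (ℓ : C(K, ℝ)) (x : K) : (NormedSpace.exp ℓ) x = Real.exp (ℓ x) := by
  have h1 := (NormedSpace.exp_series_hasSum_exp' (𝕂 := ℝ) ℓ).mapL (ContinuousMap.evalCLM ℝ x)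
  have h2 := NormedSpace.exp_series_hasSum_exp' (𝕂 := ℝ) (ℓ x)
  rw [← Real.exp_eq_exp_ℝ] at h2
  refine HasSum.unique ?_ h2
  simpa using h1

lemma nn_dense {K : Type*} [TopologicalSpace K] [CompactSpace K]
    (Λ : Submodule ℝ C(K, ℝ)) (hsep : ∀ x y : K, x ≠ y → ∃ ℓ ∈ Λ, ℓ x ≠ ℓ y) (θ : C(ℝ, ℝ))
    (hθ : ∀ j : ℕ, ∃ h x, (fwdDiff h)^[j] θ x ≠ 0) :
    (Submodule.span ℝ (Set.range fun q : Λ × ℝ =>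
      θ.comp ((q.1 : C(K, ℝ)) + q.2 • 1))).topologicalClosure = ⊤ := by
  set S := Submodule.span ℝ (Set.range fun q : Λ × ℝ =>
      θ.comp ((q.1 : C(K, ℝ)) + q.2 • 1)) with hS
  rw [eq_top_iff]
  intro f _
  by_contra hf
  obtain ⟨L, u, hLf, hLS⟩ := geometric_hahn_banach_point_closed
    (S.topologicalClosure.convex) S.isClosed_topologicalClosure hf
  have hu : u < 0 := by simpa using hLS 0 (zero_mem _)
  have hL0 : ∀ s ∈ S.topologicalClosure, L s = 0 := by
    intro s hs
    by_contra hne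
    have := hLS ((u / L s) • s) (Submodule.smul_mem _ _ hs)
    rw [map_smul, smul_eq_mul, div_mul_cancel₀ _ hne] at this
    exact lt_irrefl _ this
  have hexp : ∀ ℓ ∈ Λ, L (NormedSpace.exp ℓ) = 0 := by
    intro ℓ hℓ
    refine nn_exp_zero L ℓ fun j => nn_pow_zero L ℓ θ ?_ j (hθ j)
    intro w b
    refine hL0 _ (S.le_topologicalClosure (Submodule.subset_span ?_))
    exact ⟨(⟨w • ℓ, Λ.smul_mem w hℓ⟩, b), rfl⟩
  let M : Submonoid C(K, ℝ) :=
    { carrier := {e | ∃ ℓ ∈ Λ, NormedSpace.exp ℓ = e}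
      one_mem' := ⟨0, zero_mem _, NormedSpace.exp_zero⟩
      mul_mem' := by
        rintro _ _ ⟨a, ha, rfl⟩ ⟨b, hb, rfl⟩
        exact ⟨a + b, add_mem ha hb, NormedSpace.exp_add⟩ }
  let A : Subalgebra ℝ C(K, ℝ) := Algebra.adjoin ℝ (M : Set C(K, ℝ))
  have hA : A.topologicalClosure = ⊤ := by
    apply ContinuousMap.subalgebra_topologicalClosure_eq_top_of_separatesPoints
    intro x y hxy
    obtain ⟨ℓ, hℓ, hne⟩ := hsep x y hxy
    refine ⟨_, ⟨NormedSpace.exp ℓ, Algebra.subset_adjoin ⟨ℓ, hℓ, rfl⟩, rfl⟩, ?_⟩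
    change (NormedSpace.exp ℓ) x ≠ (NormedSpace.exp ℓ) y
    rw [nn_exp_apply, nn_exp_apply]
    exact fun h => hne (Real.exp_injective h)
  have hAL : ∀ a ∈ A, L a = 0 := by
    intro a ha
    have h1 : a ∈ Subalgebra.toSubmodule A := ha
    rw [Algebra.adjoin_eq_span, Submonoid.closure_eq] at h1
    have h2 : Submodule.span ℝ (M : Set C(K, ℝ)) ≤ LinearMap.ker L.toLinearMap := by
      rw [Submodule.span_le]
      rintro _ ⟨ℓ, hℓ, rfl⟩
      exact hexp ℓ hℓ
    exact h2 h1
  have hfA : f ∈ closure (A : Set C(K, ℝ)) := by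
    have : f ∈ A.topologicalClosure := hA ▸ Algebra.mem_top
    exact this
  have : L f = 0 := by
    have hc : IsClosed {g | L g = 0} := isClosed_eq L.continuous continuous_const
    exact closure_minimal (fun a ha => hAL a ha) hc hfA
  linarith

lemma nn_trunc_norm (n l : ℕ) (u : EuclideanSpace ℝ (Fin n)) :
    ‖radialTrunc n (l : ℝ) u‖ ≤ l ∧ ‖radialTrunc n (l : ℝ) u‖ ≤ ‖u‖ := by
  unfold radialTrunc
  split_ifs with h
  · exact ⟨h, le_rfl⟩
  · push Not at h
    have hl : (0:ℝ) ≤ l := Nat.cast_nonneg l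
    have hu : 0 < ‖u‖ := lt_of_le_of_lt hl h
    have e : ‖((l:ℝ) / ‖u‖) • u‖ = l := by
      rw [norm_smul, norm_div, Real.norm_of_nonneg hl, norm_norm, div_mul_cancel₀ _ hu.ne']
    rw [e]
    exact ⟨le_rfl, h.le⟩

/-- Uniform approximation on a cylinder. -/
lemma nn_approx (θ : ℝ → ℝ) (hθc : Continuous θ)
    (hθ : ¬ ∃ p : Polynomial ℝ, ∀ x : ℝ, θ x = p.eval x)
    (n : ℕ) (T r : ℝ)
    (g : ℝ → EuclideanSpace ℝ (Fin n) → EuclideanSpace ℝ (Fin n))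
    (hgc : Continuous fun p : ℝ × EuclideanSpace ℝ (Fin n) => g p.1 p.2)
    (ε : ℝ) (hε : 0 < ε) :
    ∃ (k : ℕ) (A : Matrix (Fin k) (Fin (n + 1)) ℝ) (a : Fin k → ℝ)
      (B : Matrix (Fin n) (Fin k) ℝ), ∀ t ∈ Set.Icc (0:ℝ) T, ∀ u, ‖u‖ ≤ r →
        ‖(WithLp.equiv 2 (Fin n → ℝ)).symm
          (B.mulVec fun j =>
            θ ((A.mulVec (Fin.cons t (WithLp.equiv 2 (Fin n → ℝ) u)
                : Fin (n + 1) → ℝ)) j + a j)) - g t u‖ < ε := by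
  classical
  let K : Set (ℝ × EuclideanSpace ℝ (Fin n)) := Set.Icc (0:ℝ) T ×ˢ Metric.closedBall 0 r
  have hK : IsCompact K := isCompact_Icc.prod (isCompact_closedBall 0 r)
  have : CompactSpace K := isCompact_iff_compactSpace.1 hK
  let cons : K → Fin (n + 1) → ℝ := fun p => Fin.cons p.1.1 (WithLp.equiv 2 (Fin n → ℝ) p.1.2)
  have hcons : ∀ i, Continuous fun p => cons p i := by
    intro i
    refine Fin.cases ?_ (fun i => ?_) i
    · simp only [cons, Fin.cons_zero]; fun_prop
    · simp only [cons, Fin.cons_succ]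
      change Continuous fun p : K => p.1.2 i
      fun_prop
  let ridge : (Fin (n + 1) → ℝ) →ₗ[ℝ] C(K, ℝ) :=
    { toFun := fun v => ⟨fun p => ∑ i, v i * cons p i, by fun_prop⟩
      map_add' := by intro v w; ext p; simp [add_mul, Finset.sum_add_distrib]
      map_smul' := by intro c v; ext p; simp [Finset.mul_sum, mul_assoc] }
  have hridge : ∀ v p, ridge v p = ∑ i, v i * cons p i := fun _ _ => rfl
  have hsep : ∀ x y : K, x ≠ y → ∃ ℓ ∈ LinearMap.range ridge, ℓ x ≠ ℓ y := by
    intro x y hxy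
    by_contra! hcon
    have hc : ∀ i, cons x i = cons y i := by
      intro i
      have := hcon (ridge (Pi.single i 1)) ⟨_, rfl⟩
      simpa [hridge, Pi.single_apply] using this
    apply hxy
    apply Subtype.ext
    refine Prod.ext (by simpa [cons] using hc 0) ?_
    ext i
    simpa [cons] using hc i.succ
  have hd : ∀ j : ℕ, ∃ h x, (fwdDiff h)^[j] θ x ≠ 0 := by
    intro j
    by_contra! hcon
    exact hθ (nn_frechet θ hθc j hcon)
  have hdense := nn_dense (LinearMap.range ridge) hsep ⟨θ, hθc⟩ hd
  let N : (Fin (n + 1) → ℝ) × ℝ → C(K, ℝ) := fun q => 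
    ContinuousMap.comp ⟨θ, hθc⟩ (ridge q.1 + q.2 • 1)
  have hcomp : ∀ i : Fin n, ∃ c : ((Fin (n + 1) → ℝ) × ℝ) →₀ ℝ, ∀ p : K,
      ‖(c.sum fun q z => z • N q) p - g p.1.1 p.1.2 i‖ < ε / (n + 1) := by
    intro i
    let gi : C(K, ℝ) := ⟨fun p => g p.1.1 p.1.2 i, by
      have : Continuous fun p : K => g p.1.1 p.1.2 := hgc.comp continuous_subtype_val
      fun_prop⟩
    have hmem : gi ∈ closure ((Submodule.span ℝ (Set.range N) : Submodule ℝ C(K, ℝ)) : Set C(K, ℝ)) := by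
      have h1 : gi ∈ (Submodule.span ℝ (Set.range fun q : LinearMap.range ridge × ℝ =>
        (ContinuousMap.mk θ hθc).comp ((q.1 : C(K, ℝ)) + q.2 • 1))).topologicalClosure := by
        rw [hdense]; trivial
      have h2 : (Set.range fun q : LinearMap.range ridge × ℝ =>
        (ContinuousMap.mk θ hθc).comp ((q.1 : C(K, ℝ)) + q.2 • 1)) ⊆ Set.range N := by
        rintro _ ⟨⟨⟨_, v, rfl⟩, b⟩, rfl⟩
        exact ⟨(v, b), rfl⟩
      exact closure_mono (Submodule.span_mono h2) h1
    obtain ⟨f, hf, hfd⟩ := Metric.mem_closure_iff.1 hmem (ε / (n + 1)) (by positivity)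
    obtain ⟨c, hc⟩ := Finsupp.mem_span_range_iff_exists_finsupp.1 hf
    refine ⟨c, fun p => ?_⟩
    rw [hc, ← dist_eq_norm, dist_comm]
    exact lt_of_le_of_lt (ContinuousMap.dist_apply_le_dist (f := gi) p) hfd
  choose c hc using hcomp
  let s : Finset ((Fin (n + 1) → ℝ) × ℝ) := Finset.univ.biUnion fun i => (c i).support
  let e := s.equivFin.symm
  refine ⟨s.card, Matrix.of fun j i => (e j).1.1 i, fun j => (e j).1.2,
    Matrix.of fun i j => c i (e j).1, ?_⟩
  intro t ht u hu
  let p : K := ⟨(t, u), ht, by simpa using hu⟩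
  have hcoord : ∀ i : Fin n, |((WithLp.equiv 2 (Fin n → ℝ)).symm
          ((Matrix.of fun i j => c i (e j).1).mulVec fun j =>
            θ (((Matrix.of fun j i => (e j).1.1 i).mulVec
              (Fin.cons t (WithLp.equiv 2 (Fin n → ℝ) u) : Fin (n + 1) → ℝ)) j + (e j).1.2))
            - g t u) i| < ε / (n + 1) := by
    intro i
    have h1 := hc i p
    rw [Real.norm_eq_abs] at h1
    convert h1 using 2
    change _ - g t u i = _ - g t u i
    congr 1
    have h2 : ((c i).sum fun q z => z • N q) = ∑ q ∈ s, c i q • N q := by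
      apply Finsupp.sum_of_support_subset
      · exact Finset.subset_biUnion_of_mem (fun i => (c i).support) (Finset.mem_univ i)
      · simp
    rw [h2, ContinuousMap.sum_apply, ← Finset.sum_coe_sort,
      ← Equiv.sum_comp e (fun q : s => (c i q.1 • N q.1) p)]
    change (∑ j, c i (e j).1 * θ ((∑ i', (e j).1.1 i' * cons p i') + (e j).1.2)) = _
    refine Finset.sum_congr rfl fun j _ => ?_
    simp [N, hridge]
  generalize ((WithLp.equiv 2 (Fin n → ℝ)).symm
          ((Matrix.of fun i j => c i (e j).1).mulVec fun j =>
            θ (((Matrix.of fun j i => (e j).1.1 i).mulVec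
              (Fin.cons t (WithLp.equiv 2 (Fin n → ℝ) u) : Fin (n + 1) → ℝ)) j + (e j).1.2))
            - g t u) = v at hcoord ⊢
  have hδ : 0 < ε / (n + 1) := by positivity
  have h1 : ‖v‖ ≤ ∑ i, |v i| := by
    rw [EuclideanSpace.norm_eq]
    apply Real.sqrt_le_iff.2
    refine ⟨Finset.sum_nonneg fun i _ => abs_nonneg _, ?_⟩
    simp only [Real.norm_eq_abs]
    exact Finset.sum_sq_le_sq_sum_of_nonneg (fun i _ => abs_nonneg _)
  have h2 : ∑ i, |v i| ≤ n * (ε / (n + 1)) := by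
    calc ∑ i, |v i| ≤ ∑ _i : Fin n, ε / (n + 1) := Finset.sum_le_sum fun i _ => (hcoord i).le
      _ = _ := by simp
  have h3 : (n + 1) * (ε / (n + 1)) = ε := by field_simp
  linarith

theorem uniform_approximation_property_neural_ansatz
    (θ : ℝ → ℝ) (hθc : Continuous θ)
    (hθ : ¬ ∃ p : Polynomial ℝ, ∀ x : ℝ, θ x = p.eval x)
    (n : ℕ) (T : ℝ) (hT : 0 < T) (C : ℝ) (hC : 0 < C)
    (g : ℝ → EuclideanSpace ℝ (Fin n) → EuclideanSpace ℝ (Fin n))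
    (hgc : Continuous fun p : ℝ × EuclideanSpace ℝ (Fin n) => g p.1 p.2)
    (hg : ∀ t ∈ Set.Icc (0 : ℝ) T, ∀ u, ‖g t u‖ ≤ C * (1 + ‖u‖)) :
    ∃ G : ℕ → ℝ → EuclideanSpace ℝ (Fin n) → EuclideanSpace ℝ (Fin n),
      -- each `G m` is a one-layer network precomposed with a radial truncation
      (∀ m : ℕ, ∃ (k l : ℕ) (A : Matrix (Fin k) (Fin (n + 1)) ℝ) (a : Fin k → ℝ)
        (B : Matrix (Fin n) (Fin k) ℝ),
        ∀ t u, G m t u = (WithLp.equiv 2 (Fin n → ℝ)).symm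
          (B.mulVec fun j =>
            θ ((A.mulVec (Fin.cons t
                (WithLp.equiv 2 (Fin n → ℝ) (radialTrunc n (l : ℝ) u))
                : Fin (n + 1) → ℝ)) j + a j))) ∧
      -- uniform linear growth
      (∀ m : ℕ, ∀ t ∈ Set.Icc (0 : ℝ) T, ∀ u,
        ‖G m t u‖ ≤ (C + 1) * (1 + ‖u‖)) ∧
      -- locally uniform convergence to `g`
      (∀ R : ℝ, 0 < R → ∀ ε : ℝ, 0 < ε →
        ∃ M : ℕ, ∀ m : ℕ, M ≤ m → ∀ t ∈ Set.Icc (0 : ℝ) T, ∀ u, ‖u‖ ≤ R →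
          ‖G m t u - g t u‖ < ε) := by
  have hex := fun m : ℕ => nn_approx θ hθc hθ n T (m : ℝ) g hgc (1 / ((m : ℝ) + 1)) (by positivity)
  choose k A a B hAB using hex
  have hle1 : ∀ m : ℕ, 1 / ((m : ℝ) + 1) ≤ 1 := by
    intro m
    rw [div_le_one (by positivity)]
    linarith [(Nat.cast_nonneg m : (0:ℝ) ≤ m)]
  refine ⟨fun m t u => (WithLp.equiv 2 (Fin n → ℝ)).symm
          ((B m).mulVec fun j =>
            θ (((A m).mulVec (Fin.cons t
                (WithLp.equiv 2 (Fin n → ℝ) (radialTrunc n (m : ℝ) u))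
                : Fin (n + 1) → ℝ)) j + a m j)),
    fun m => ⟨k m, m, A m, a m, B m, fun t u => rfl⟩, ?_, ?_⟩
  · intro m t ht u
    obtain ⟨h1, h2⟩ := nn_trunc_norm n m u
    have h3 := hAB m t ht _ h1
    have h4 := hg t ht (radialTrunc n (m : ℝ) u)
    have h5 := hle1 m
    have h6 := norm_le_norm_sub_add ((WithLp.equiv 2 (Fin n → ℝ)).symm
          ((B m).mulVec fun j =>
            θ (((A m).mulVec (Fin.cons t
                (WithLp.equiv 2 (Fin n → ℝ) (radialTrunc n (m : ℝ) u))
                : Fin (n + 1) → ℝ)) j + a m j))) (g t (radialTrunc n (m : ℝ) u))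
    have h7 : C * (1 + ‖radialTrunc n (m : ℝ) u‖) ≤ C * (1 + ‖u‖) := by gcongr
    have h8 := norm_nonneg u
    linarith
  · intro R _ ε hε
    obtain ⟨M₁, hM₁⟩ := exists_nat_ge R
    obtain ⟨M₂, hM₂⟩ := exists_nat_one_div_lt hε
    refine ⟨max M₁ M₂, fun m hm t ht u hu => ?_⟩
    have hm1 : (M₁ : ℝ) ≤ m := by exact_mod_cast (le_max_left _ _).trans hm
    have hm2 : (M₂ : ℝ) ≤ m := by exact_mod_cast (le_max_right _ _).trans hm
    have hum : ‖u‖ ≤ m := by linarith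
    have e : radialTrunc n (m : ℝ) u = u := if_pos hum
    simp only [e]
    refine (hAB m t ht u hum).trans_le (le_trans ?_ hM₂.le)
    gcongr
end
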